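/- For every n ≥ 1, the number K(n) of nonattacking placements of exactly n² kings on the 2n×2n chessboard satisfies K(n) = Σ_{A ⊆ {1,…,n}} Σ_{k=1}^{n+1} m^n_{A,k}. -/

import Mathlib

/-- A placement of kings on an `m × n` board (positions 0-indexed) is nonattacking
if any two distinct positions are at Chebyshev distance at least 2. -/
def Nonattacking {m n : ℕ} (S : Finset (Fin m × Fin n)) : Prop :=
  ∀ p ∈ S, ∀ q ∈ S, p ≠ q →
    2 ≤ max (Nat.dist (p.1 : ℕ) (q.1 : ℕ)) (Nat.dist (p.2 : ℕ) (q.2 : ℕ))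

/-- `p(A,B,k) = max({i ∈ {1,…,n+1} : i < k, i ∉ A, i−1 ∈ B} ∪ {1})`. -/
def pFun (n : ℕ) (A B : Finset ℕ) (k : ℕ) : ℕ :=
  (insert 1 ((Finset.Icc 1 (n + 1)).filter (fun i => i < k ∧ i ∉ A ∧ i - 1 ∈ B))).max'
    (Finset.insert_nonempty _ _)

/-- `q(A,B,k) = min({i ∈ {1,…,n+1} : i > k, i ∈ B, i−1 ∉ A} ∪ {n+1})`. -/
def qFun (n : ℕ) (A B : Finset ℕ) (k : ℕ) : ℕ :=
  (insert (n + 1) ((Finset.Icc 1 (n + 1)).filter (fun i => k < i ∧ i ∈ B ∧ i - 1 ∉ A))).min'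
    (Finset.insert_nonempty _ _)

/-- The matrix entries `m^ℓ_{A,k}`: `m^1_{A,k} = 1` and, for `ℓ > 1`,
`m^ℓ_{A,k} = Σ_{B ⊆ A} Σ_{i = p(A,B,k)}^{q(A,B,k)} m^{ℓ−1}_{B,i}`. -/
def mEnt (n : ℕ) : ℕ → Finset ℕ → ℕ → ℕ
  | 0, _, _ => 0
  | 1, _, _ => 1
  | ℓ + 2, A, k =>
      ∑ B ∈ A.powerset, ∑ i ∈ Finset.Icc (pFun n A B k) (qFun n A B k), mEnt n (ℓ + 1) B i

/-- A recursively defined weight counting chains for a relation on a finite type. -/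
theorem weight_eq_card_chains {S : Type*} [Fintype S] (R : S → S → Prop) (w : ℕ → S → ℕ)
    [DecidableRel R] (h0 : ∀ s, w 0 s = 1)
    (hsucc : ∀ l s, w (l + 1) s = ∑ t, if R s t then w l t else 0) (l : ℕ) (s : S) :
    w l s = ∑ f : Fin l → S,
      if ∀ i : Fin l, R (Fin.cons (α := fun _ => S) s f i.castSucc) (f i) then 1 else 0 := by
  induction l generalizing s with
  | zero => simp [h0]
  | succ l ih =>
    rw [hsucc, ← (Fin.consEquiv fun _ : Fin (l + 1) => S).sum_comp, Fintype.sum_prod_type]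
    refine Finset.sum_congr rfl fun t _ => ?_
    rw [ih t]
    split_ifs with h
    · refine Finset.sum_congr rfl fun g _ => ?_
      simp [Fin.forall_fin_succ, Fin.consEquiv, h]
    · simp [Fin.forall_fin_succ, Fin.consEquiv, h]

theorem sum_weight_eq_card_chains {S : Type*} [Fintype S] (R : S → S → Prop) (w : ℕ → S → ℕ)
    (h0 : ∀ s, w 0 s = 1) [DecidableRel R]
    (hsucc : ∀ l s, w (l + 1) s = ∑ t, if R s t then w l t else 0) (l : ℕ) :
    ∑ s, w l s = Set.ncard {f : Fin (l + 1) → S | ∀ i : Fin l, R (f i.castSucc) (f i.succ)} := by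
  classical
  have : {f : Fin (l + 1) → S | ∀ i : Fin l, R (f i.castSucc) (f i.succ)} =
      ↑(Finset.univ.filter fun f : Fin (l + 1) → S =>
        ∀ i : Fin l, R (f i.castSucc) (f i.succ)) := by
    ext; simp
  rw [this, Set.ncard_coe_finset, Finset.card_filter,
    ← (Fin.consEquiv fun _ : Fin (l + 1) => S).sum_comp, Fintype.sum_prod_type]
  refine Finset.sum_congr rfl fun s _ => ?_
  rw [weight_eq_card_chains R w h0 hsucc]
  refine Finset.sum_congr rfl fun g _ => ?_
  simp [Fin.consEquiv]

theorem pFun_le_iff {n : ℕ} {A B : Finset ℕ} {k i : ℕ} :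
    pFun n A B k ≤ i ↔ 1 ≤ i ∧ ∀ j, 1 ≤ j → j ≤ n + 1 → j < k → j ∉ A → j - 1 ∈ B → j ≤ i := by
  rw [pFun, Finset.max'_le_iff]
  simp only [Finset.mem_insert, Finset.mem_filter, Finset.mem_Icc, forall_eq_or_imp]
  grind

theorem le_qFun_iff {n : ℕ} {A B : Finset ℕ} {k i : ℕ} :
    i ≤ qFun n A B k ↔
      i ≤ n + 1 ∧ ∀ j, 1 ≤ j → j ≤ n + 1 → k < j → j ∈ B → j - 1 ∉ A → i ≤ j := by
  rw [qFun, Finset.le_min'_iff]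
  simp only [Finset.mem_insert, Finset.mem_filter, Finset.mem_Icc, forall_eq_or_imp]
  grind

/-- The possible states of a row of `2 × 2` blocks: the set of blocks whose king is in the upper
half, and the first block whose king is in the right half. -/
abbrev RowState (n : ℕ) : Type :=
  ((Finset.Icc 1 n).powerset ×ˢ Finset.Icc 1 (n + 1) : Finset (Finset ℕ × ℕ))

namespace RowState

variable {n : ℕ}

theorem subset (s : RowState n) : s.1.1 ⊆ Finset.Icc 1 n :=
  Finset.mem_powerset.1 (Finset.mem_product.1 s.2).1

theorem one_le (s : RowState n) : 1 ≤ s.1.2 :=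
  (Finset.mem_Icc.1 (Finset.mem_product.1 s.2).2).1

theorem le (s : RowState n) : s.1.2 ≤ n + 1 :=
  (Finset.mem_Icc.1 (Finset.mem_product.1 s.2).2).2

/-- The vertical offset, within its block, of the king in block `c`. -/
def up (s : RowState n) (c : ℕ) : ℕ := if c + 1 ∈ s.1.1 then 0 else 1

/-- The horizontal offset, within its block, of the king in block `c`. -/
def right (s : RowState n) (c : ℕ) : ℕ := if s.1.2 ≤ c + 1 then 1 else 0

theorem up_lt (s : RowState n) (c : ℕ) : s.up c < 2 := by
  unfold up; split_ifs <;> omega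

theorem right_lt (s : RowState n) (c : ℕ) : s.right c < 2 := by
  unfold right; split_ifs <;> omega

theorem right_mono (s : RowState n) {c d : ℕ} (h : c ≤ d) : s.right c ≤ s.right d := by
  unfold right; split_ifs <;> omega

/-- `t` may be placed directly below `s`. -/
def Compat (s t : RowState n) : Prop :=
  t.1.1 ⊆ s.1.1 ∧ pFun n s.1.1 t.1.1 s.1.2 ≤ t.1.2 ∧ t.1.2 ≤ qFun n s.1.1 t.1.1 s.1.2

theorem compat_iff (s t : RowState n) :
    s.Compat t ↔ ∀ c < n, ∀ d < n, s.up c = 1 → t.up d = 0 →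
      2 ≤ Nat.dist (2 * c + s.right c) (2 * d + t.right d) := by
  obtain ⟨⟨A, k⟩, hs⟩ := s
  obtain ⟨⟨B, i⟩, ht⟩ := t
  simp only [Finset.mem_product, Finset.mem_powerset, Finset.mem_Icc] at hs ht
  simp only [Compat, pFun_le_iff, le_qFun_iff, up, right, ht.2.1, ht.2.2, true_and]
  have hB : ∀ x ∈ B, 1 ≤ x ∧ x ≤ n := fun x hx => Finset.mem_Icc.1 (ht.1 hx)
  constructor
  · rintro ⟨hBA, hp, hq⟩ c hc d hd h1 h2
    have hcA : c + 1 ∉ A := by grind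
    have hdB : d + 1 ∈ B := by grind
    have hcd : c ≠ d := fun h => hcA (hBA (h ▸ hdB))
    have hp' := fun h : c = d + 1 => hp (c + 1) (by omega) (by omega)
    have hq' := fun h : d = c + 1 => hq (d + 1) (by omega) (by omega)
    unfold Nat.dist
    rcases lt_trichotomy c d with h | h | h
    · by_cases e : d = c + 1
      · subst e
        have := fun hk => hq' rfl hk hdB hcA
        split_ifs <;> omega
      · split_ifs <;> omega
    · exact absurd h hcd
    · by_cases e : c = d + 1
      · subst e
        have := fun hk => hp' rfl hk hcA hdB
        split_ifs <;> omega
      · split_ifs <;> omega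
  · intro H
    unfold Nat.dist at H
    refine ⟨fun x hx => ?_, fun j h1 h2 hjk hjA hjB => ?_, fun j h1 h2 hkj hjB hjA => ?_⟩
    · by_contra hxA
      have := hB x hx
      obtain ⟨c, rfl⟩ : ∃ c, x = c + 1 := ⟨x - 1, by omega⟩
      have := H c (by omega) c (by omega) (by simp [hxA]) (by simp [hx])
      split_ifs at this <;> omega
    · by_contra hij
      have := hB _ hjB
      obtain ⟨d, rfl⟩ : ∃ d, j = d + 1 + 1 := ⟨j - 2, by omega⟩
      have := H (d + 1) (by omega) d (by omega) (by simp [hjA]) (by simpa using hjB)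
      split_ifs at this <;> omega
    · by_contra hij
      have := hB _ hjB
      obtain ⟨d, rfl⟩ : ∃ d, j = d + 1 + 1 := ⟨j - 2, by omega⟩
      have := H d (by omega) (d + 1) (by omega) (by simpa using hjA) (by simpa using hjB)
      split_ifs at this <;> omega

/-- Two states with the same kings are equal. -/
theorem ext_offsets {s t : RowState n} (hu : ∀ c < n, s.up c = t.up c)
    (hr : ∀ c < n, s.right c = t.right c) : s = t := by
  have hs := s.subset
  have ht := t.subset
  have hs1 := s.one_le
  have ht1 := t.one_le
  have hs2 := s.le
  have ht2 := t.le
  obtain ⟨⟨A, k⟩, _⟩ := s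
  obtain ⟨⟨B, i⟩, _⟩ := t
  simp only [up, right] at hu hr hs ht hs1 ht1 hs2 ht2
  have hk : k = i := by
    rcases lt_trichotomy k i with h | h | h
    · have := hr (k - 1) (by omega)
      split_ifs at this <;> omega
    · exact h
    · have := hr (i - 1) (by omega)
      split_ifs at this <;> omega
  have hA : A = B := by
    ext x
    by_cases hx : x ∈ Finset.Icc 1 n
    · rw [Finset.mem_Icc] at hx
      have := hu (x - 1) (by omega)
      rw [Nat.sub_add_cancel hx.1] at this
      grind
    · exact iff_of_false (fun h => hx (hs h)) fun h => hx (ht h)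
  subst hk hA
  rfl

/-- Offsets that never increase to the left come from a state. -/
theorem exists_offsets (n : ℕ) (u v : ℕ → ℕ) (hu : ∀ c < n, u c < 2) (hv : ∀ c < n, v c < 2)
    (hmono : ∀ c, c + 1 < n → v c ≤ v (c + 1)) :
    ∃ s : RowState n, ∀ c < n, s.up c = u c ∧ s.right c = v c := by
  classical
  have hex : ∃ k, k < n → v k = 1 := ⟨n, fun h => absurd h (lt_irrefl n)⟩
  have hle : Nat.find hex ≤ n := Nat.find_min' hex fun h => absurd h (lt_irrefl n)
  refine ⟨⟨((Finset.Icc 1 n).filter fun x => u (x - 1) = 0, Nat.find hex + 1), ?_⟩, ?_⟩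
  · simp only [Finset.mem_product, Finset.mem_powerset, Finset.mem_Icc, Finset.filter_subset,
      true_and]
    omega
  · intro c hc
    have := hu c hc
    refine ⟨?_, ?_⟩
    · simp only [up, Finset.mem_filter, Finset.mem_Icc, Nat.add_sub_cancel]
      split_ifs <;> omega
    · simp only [right, Nat.add_le_add_iff_right]
      split_ifs with h
      · clear this
        induction c, h using Nat.le_induction with
        | base => exact (Nat.find_spec hex hc).symm
        | succ c h ih =>
          have h1 := ih (by omega)
          have h2 := hmono c hc
          have h3 := hv _ hc
          omega
      · have h1 := Nat.find_min hex (not_le.1 h)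
        have h2 := hv c hc
        push Not at h1
        omega

theorem mEnt_succ (l : ℕ) [DecidableRel (Compat (n := n))] (s : RowState n) :
    mEnt n (l + 2) s.1.1 s.1.2 =
      ∑ t : RowState n, if s.Compat t then mEnt n (l + 1) t.1.1 t.1.2 else 0 := by
  classical
  have hA := s.subset
  let F : Finset ℕ × ℕ → ℕ := fun t =>
    if t.1 ⊆ s.1.1 ∧ pFun n s.1.1 t.1 s.1.2 ≤ t.2 ∧ t.2 ≤ qFun n s.1.1 t.1 s.1.2 then
      mEnt n (l + 1) t.1 t.2 else 0
  have hF : ∀ t ∈ (Finset.univ : Finset (RowState n)),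
      (if s.Compat t then mEnt n (l + 1) t.1.1 t.1.2 else 0) = F t :=
    fun t _ => if_congr Iff.rfl rfl rfl
  rw [Finset.sum_congr rfl hF, Finset.sum_coe_sort _ F, Finset.sum_product, mEnt]
  simp only [F]
  have hpow : s.1.1.powerset = (Finset.Icc 1 n).powerset.filter (· ⊆ s.1.1) := by
    ext B
    simp only [Finset.mem_powerset, Finset.mem_filter]
    exact ⟨fun h => ⟨h.trans hA, h⟩, And.right⟩
  rw [hpow, Finset.sum_filter]
  refine Finset.sum_congr rfl fun B _ => ?_
  split_ifs with h
  · have hIcc : Finset.Icc (pFun n s.1.1 B s.1.2) (qFun n s.1.1 B s.1.2) =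
        (Finset.Icc 1 (n + 1)).filter fun i =>
          pFun n s.1.1 B s.1.2 ≤ i ∧ i ≤ qFun n s.1.1 B s.1.2 := by
      ext i
      simp only [Finset.mem_filter, Finset.mem_Icc]
      exact ⟨fun hi => ⟨⟨(pFun_le_iff.1 hi.1).1, (le_qFun_iff.1 hi.2).1⟩, hi⟩, And.right⟩
    rw [hIcc, Finset.sum_filter]
    simp [h]
  · simp [h]

end RowState

/-- The position of the king in the block `b`. -/
def kingPos {n : ℕ} (f : Fin n → RowState n) (b : Fin n × Fin n) : Fin (2 * n) × Fin (2 * n) :=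
  (⟨2 * b.1 + (f b.1).up b.2, by have := (f b.1).up_lt b.2; omega⟩,
    ⟨2 * b.2 + (f b.1).right b.2, by have := (f b.1).right_lt b.2; omega⟩)

/-- The placement described by a sequence of row states. -/
def kingSet {n : ℕ} (f : Fin n → RowState n) : Finset (Fin (2 * n) × Fin (2 * n)) :=
  Finset.univ.image (kingPos f)

theorem eq_of_kingPos_eq {n : ℕ} {f g : Fin n → RowState n} {b c : Fin n × Fin n}
    (h : kingPos f b = kingPos g c) :
    b = c ∧ (f b.1).up b.2 = (g b.1).up b.2 ∧ (f b.1).right b.2 = (g b.1).right b.2 := by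
  simp only [kingPos, Prod.mk.injEq, Fin.mk.injEq] at h
  have h1 := (f b.1).up_lt b.2
  have h2 := (f b.1).right_lt b.2
  have h3 := (g c.1).up_lt c.2
  have h4 := (g c.1).right_lt c.2
  have hbc : b = c := Prod.ext (Fin.ext (by omega)) (Fin.ext (by omega))
  subst hbc
  exact ⟨rfl, by omega, by omega⟩

theorem kingPos_injective {n : ℕ} (f : Fin n → RowState n) : Function.Injective (kingPos f) :=
  fun _ _ h => (eq_of_kingPos_eq h).1

theorem kingSet_card {n : ℕ} (f : Fin n → RowState n) : (kingSet f).card = n ^ 2 := by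
  rw [kingSet, Finset.card_image_of_injective _ (kingPos_injective f)]
  simp [sq]

theorem kingSet_injective {n : ℕ} : Function.Injective (kingSet (n := n)) := by
  intro f g h
  have key : ∀ b : Fin n × Fin n,
      (f b.1).up b.2 = (g b.1).up b.2 ∧ (f b.1).right b.2 = (g b.1).right b.2 := by
    intro b
    have hb : kingPos f b ∈ kingSet g := h ▸ Finset.mem_image_of_mem _ (Finset.mem_univ b)
    obtain ⟨c, -, hc⟩ := Finset.mem_image.1 hb
    exact (eq_of_kingPos_eq hc.symm).2
  funext r
  exact RowState.ext_offsets (fun c hc => (key (r, ⟨c, hc⟩)).1) fun c hc => (key (r, ⟨c, hc⟩)).2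

theorem nonattacking_kingSet_iff {n : ℕ} (f : Fin n → RowState n) :
    Nonattacking (kingSet f) ↔ ∀ r r' : Fin n, (r' : ℕ) = r + 1 → (f r).Compat (f r') := by
  constructor
  · intro H r r' hr
    rw [RowState.compat_iff]
    intro c hc d hd h1 h2
    have := H (kingPos f (r, ⟨c, hc⟩)) (Finset.mem_image_of_mem _ (Finset.mem_univ _))
      (kingPos f (r', ⟨d, hd⟩)) (Finset.mem_image_of_mem _ (Finset.mem_univ _))
      (fun h => by
        have := congrArg (fun b : Fin n × Fin n => (b.1 : ℕ)) (eq_of_kingPos_eq h).1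
        simp only at this
        omega)
    simp only [kingPos, h1, h2] at this
    rcases le_max_iff.1 this with h | h
    · unfold Nat.dist at h
      omega
    · exact h
  · intro H
    have key : ∀ b c : Fin n × Fin n, b ≠ c → b.1 ≤ c.1 →
        2 ≤ max (Nat.dist ((kingPos f b).1 : ℕ) ((kingPos f c).1 : ℕ))
          (Nat.dist ((kingPos f b).2 : ℕ) ((kingPos f c).2 : ℕ)) := by
      intro b c hbc hle
      obtain ⟨r, x⟩ := b
      obtain ⟨r', y⟩ := c
      simp only [kingPos, le_max_iff]
      have h1 := (f r).up_lt x
      have h2 := (f r').up_lt y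
      rcases Nat.lt_trichotomy (r' : ℕ) (r + 1) with h | h | h
      · have hrr : r = r' := le_antisymm hle (by rw [Fin.le_def]; omega)
        subst hrr
        right
        have hxy : (x : ℕ) ≠ y := fun e => hbc (by rw [Fin.ext e])
        unfold Nat.dist
        rcases lt_or_gt_of_ne hxy with h | h
        · have := (f r).right_mono h.le
          omega
        · have := (f r).right_mono h.le
          omega
      · by_cases hu : (f r).up x = 1 ∧ (f r').up y = 0
        · right
          exact (RowState.compat_iff _ _).1 (H r r' h) x x.2 y y.2 hu.1 hu.2
        · left
          unfold Nat.dist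
          omega
      · left
        unfold Nat.dist
        omega
    intro p hp q hq hpq
    obtain ⟨b, -, rfl⟩ := Finset.mem_image.1 hp
    obtain ⟨c, -, rfl⟩ := Finset.mem_image.1 hq
    have hbc : b ≠ c := fun h => hpq (h ▸ rfl)
    rcases le_total b.1 c.1 with h | h
    · exact key b c hbc h
    · have := key c b hbc.symm h
      rwa [Nat.dist_comm, Nat.dist_comm ((kingPos f c).2 : ℕ)] at this

/-- A nonattacking placement of `n ^ 2` kings has exactly one king in each `2 × 2` block. -/
theorem Nonattacking.exists_mem_block {n : ℕ} {S : Finset (Fin (2 * n) × Fin (2 * n))}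
    (hS : Nonattacking S) (hcard : S.card = n ^ 2) (b : Fin n × Fin n) :
    ∃ p ∈ S, (p.1 : ℕ) / 2 = b.1 ∧ (p.2 : ℕ) / 2 = b.2 := by
  let g : Fin (2 * n) × Fin (2 * n) → Fin n × Fin n :=
    fun p => (⟨p.1 / 2, by omega⟩, ⟨p.2 / 2, by omega⟩)
  have hinj : Set.InjOn g S := by
    intro p hp q hq h
    by_contra hpq
    have := hS p hp q hq hpq
    simp only [g, Prod.mk.injEq, Fin.mk.injEq] at h
    rw [le_max_iff] at this
    unfold Nat.dist at this
    omega
  have himg : S.image g = Finset.univ := by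
    rw [← Finset.card_eq_iff_eq_univ, Finset.card_image_of_injOn hinj, hcard]
    simp [sq]
  obtain ⟨p, hp, hpb⟩ := Finset.mem_image.1 (himg ▸ Finset.mem_univ b)
  exact ⟨p, hp, by simp [← hpb, g], by simp [← hpb, g]⟩

theorem Nonattacking.exists_kingSet_eq {n : ℕ} {S : Finset (Fin (2 * n) × Fin (2 * n))}
    (hS : Nonattacking S) (hcard : S.card = n ^ 2) : ∃ f, kingSet f = S := by
  choose p hpS hp1 hp2 using hS.exists_mem_block hcard
  have hrow : ∀ r : Fin n, ∃ s : RowState n, ∀ c : Fin n,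
      s.up c = (p (r, c)).1 % 2 ∧ s.right c = (p (r, c)).2 % 2 := by
    intro r
    obtain ⟨s, hs⟩ := RowState.exists_offsets n
      (fun c => if h : c < n then ((p (r, ⟨c, h⟩)).1 : ℕ) % 2 else 0)
      (fun c => if h : c < n then ((p (r, ⟨c, h⟩)).2 : ℕ) % 2 else 0)
      (fun c hc => by simp only [hc, dite_true]; omega)
      (fun c hc => by simp only [hc, dite_true]; omega)
      (fun c hc => by
        have hc' : c < n := by omega
        simp only [hc, hc', dite_true]
        have a1 := hp1 (r, ⟨c, hc'⟩)
        have a2 := hp2 (r, ⟨c, hc'⟩)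
        have b1 := hp1 (r, ⟨c + 1, hc⟩)
        have b2 := hp2 (r, ⟨c + 1, hc⟩)
        simp only at a1 a2 b1 b2
        have hne : p (r, ⟨c, hc'⟩) ≠ p (r, ⟨c + 1, hc⟩) := fun h => by
          rw [h] at a2
          omega
        have := hS _ (hpS (r, ⟨c, hc'⟩)) _ (hpS (r, ⟨c + 1, hc⟩)) hne
        rw [le_max_iff] at this
        unfold Nat.dist at this
        omega)
    refine ⟨s, fun c => ?_⟩
    have := hs c c.2
    simpa only [c.2, dite_true] using this
  choose f hf using hrow
  refine ⟨f, Finset.eq_of_subset_of_card_le (fun q hq => ?_) (by rw [kingSet_card, hcard])⟩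
  obtain ⟨b, -, rfl⟩ := Finset.mem_image.1 hq
  have hpos : kingPos f b = p b := by
    obtain ⟨r, c⟩ := b
    have h1 : ((p (r, c)).1 : ℕ) / 2 = r := hp1 (r, c)
    have h2 : ((p (r, c)).2 : ℕ) / 2 = c := hp2 (r, c)
    have h3 := hf r c
    refine Prod.ext (Fin.ext ?_) (Fin.ext ?_)
    · simp only [kingPos, h3.1]
      omega
    · simp only [kingPos, h3.2]
      omega
  exact hpos ▸ hpS b

/-- The number of nonattacking placements of `n²` kings on the `2n × 2n` chessboard
equals `Σ_{A ⊆ {1,…,n}} Σ_{k=1}^{n+1} m^n_{A,k}`. -/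
theorem count_kings_even_board (n : ℕ) (hn : 1 ≤ n) :
    Set.ncard {S : Finset (Fin (2 * n) × Fin (2 * n)) |
        Nonattacking S ∧ S.card = n ^ 2} =
      ∑ A ∈ (Finset.Icc 1 n).powerset, ∑ k ∈ Finset.Icc 1 (n + 1), mEnt n n A k := by
  classical
  have himg : {S : Finset (Fin (2 * n) × Fin (2 * n)) | Nonattacking S ∧ S.card = n ^ 2} =
      kingSet '' {f | ∀ r r' : Fin n, (r' : ℕ) = r + 1 → (f r).Compat (f r')} := by
    ext S
    constructor
    · rintro ⟨hS, hcard⟩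
      obtain ⟨f, rfl⟩ := hS.exists_kingSet_eq hcard
      exact ⟨f, (nonattacking_kingSet_iff f).1 hS, rfl⟩
    · rintro ⟨f, hf, rfl⟩
      exact ⟨(nonattacking_kingSet_iff f).2 hf, kingSet_card f⟩
  rw [himg, Set.ncard_image_of_injective _ kingSet_injective, ← Finset.sum_product',
    ← Finset.sum_coe_sort]
  obtain ⟨m, rfl⟩ : ∃ m, n = m + 1 := ⟨n - 1, by omega⟩
  have hcount := sum_weight_eq_card_chains (RowState.Compat (n := m + 1))
    (fun l s => mEnt (m + 1) (l + 1) s.1.1 s.1.2) (fun _ => by simp [mEnt])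
    (fun l s => RowState.mEnt_succ l s) m
  rw [hcount]
  congr 1
  ext f
  constructor
  · intro H i
    exact H _ _ (by simp)
  · intro H r r' h
    have hr := H ⟨r, by omega⟩
    have e1 : (⟨r, by omega⟩ : Fin m).castSucc = r := rfl
    have e2 : (⟨r, by omega⟩ : Fin m).succ = r' := Fin.ext h.symm
    rwa [e1, e2] at hr
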